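/- arXiv:1711.10071 — 5 statements merged into one kernel-verified Lean document; each statement's English description precedes it below -/
import Mathlib

section
/- Let 0 < α < 1, s > 0, and let f : ℝ → ℝ be continuously differentiable on [0,∞) such that both t ↦ e^{−st}|f(t)| and t ↦ e^{−st}|f′(t)| are integrable on (0,∞) and e^{−st} f(t) → 0 as t → ∞. Then the Laplace transform of the Caputo fractional derivative of f satisfies ∫₀^∞ e^{−st} · ((1/Γ(1−α)) ∫₀^t (t−τ)^{−α} f′(τ) dτ) dt = s^α F(s) − s^{α−1} f(0), where F(s) = ∫₀^∞ e^{−st} f(t) dt. -/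
open MeasureTheory Real

/-- Absolute integrability against an exponential weight gives integrability, for a function
continuous on `[0, ∞)`. -/
lemma integrableOn_exp_mul_of_abs {s : ℝ} {g : ℝ → ℝ} (hg : ContinuousOn g (Set.Ici 0))
    (h : IntegrableOn (fun t => Real.exp (-s * t) * |g t|) (Set.Ioi 0)) :
    IntegrableOn (fun t => Real.exp (-s * t) * g t) (Set.Ioi 0) := by
  have hc : ContinuousOn (fun t => Real.exp (-s * t) * g t) (Set.Ioi 0) :=
    ContinuousOn.mul (by fun_prop) (hg.mono Set.Ioi_subset_Ici_self)
  refine Integrable.mono' h (hc.aestronglyMeasurable measurableSet_Ioi) (.of_forall fun t => ?_)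
  simp

/-- The Laplace transform of a derivative. -/
lemma integral_exp_mul_deriv {s : ℝ} {f f' : ℝ → ℝ}
    (hderiv : ∀ t ∈ Set.Ici (0:ℝ), HasDerivAt f (f' t) t)
    (hf : IntegrableOn (fun t => Real.exp (-s * t) * f t) (Set.Ioi 0))
    (hf' : IntegrableOn (fun t => Real.exp (-s * t) * f' t) (Set.Ioi 0))
    (hlim : Filter.Tendsto (fun t => Real.exp (-s * t) * f t) Filter.atTop (nhds 0)) :
    ∫ t in Set.Ioi (0:ℝ), Real.exp (-s * t) * f' t =
      s * (∫ t in Set.Ioi (0:ℝ), Real.exp (-s * t) * f t) - f 0 := by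
  have hd : ∀ t ∈ Set.Ici (0:ℝ), HasDerivAt (fun t => Real.exp (-s * t) * f t)
      (Real.exp (-s * t) * f' t - s * (Real.exp (-s * t) * f t)) t := fun t ht => by
    have he : HasDerivAt (fun t => Real.exp (-s * t)) (Real.exp (-s * t) * -s) t := by
      simpa using ((hasDerivAt_id t).const_mul (-s)).exp
    exact (he.mul (hderiv t ht)).congr_deriv (by ring)
  have key := integral_Ioi_of_hasDerivAt_of_tendsto' hd (hf'.sub (hf.const_mul s)) hlim
  rw [integral_sub hf' (hf.const_mul s), integral_const_mul] at key
  simp only [mul_zero, Real.exp_zero, one_mul] at key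
  linarith

/-- The Laplace transform of a causal convolution is the product of the Laplace transforms. -/
lemma integral_exp_mul_convolution {s : ℝ} {g k : ℝ → ℝ}
    (hg : IntegrableOn (fun t => Real.exp (-s * t) * g t) (Set.Ioi 0))
    (hk : IntegrableOn (fun t => Real.exp (-s * t) * k t) (Set.Ioi 0)) :
    ∫ t in Set.Ioi (0:ℝ), Real.exp (-s * t) * ∫ τ in (0:ℝ)..t, k (t - τ) * g τ =
      (∫ t in Set.Ioi (0:ℝ), Real.exp (-s * t) * g t) *
        ∫ t in Set.Ioi (0:ℝ), Real.exp (-s * t) * k t := by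
  have h := integral_posConvolution hg hk (ContinuousLinearMap.mul ℝ ℝ)
  simp only [ContinuousLinearMap.mul_apply'] at h
  rw [← h]
  congr 1 with t
  rw [← intervalIntegral.integral_const_mul]
  congr 1 with τ
  have he : Real.exp (-s * t) = Real.exp (-s * τ) * Real.exp (-s * (t - τ)) := by
    rw [← Real.exp_add]; ring_nf
  rw [he]; ring

/-- Laplace transform of the Caputo fractional derivative for `0 < α < 1`:
`L{D^α f}(s) = s^α F(s) - s^{α-1} f(0)`. -/
theorem laplace_caputo_derivative
    (α s : ℝ) (hα : α ∈ Set.Ioo (0:ℝ) 1) (hs : 0 < s)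
    (f f' : ℝ → ℝ)
    (hderiv : ∀ t ∈ Set.Ici (0:ℝ), HasDerivAt f (f' t) t)
    (hcont : ContinuousOn f' (Set.Ici 0))
    (hf_int : IntegrableOn (fun t => Real.exp (-s * t) * |f t|) (Set.Ioi 0))
    (hf'_int : IntegrableOn (fun t => Real.exp (-s * t) * |f' t|) (Set.Ioi 0))
    (hlim : Filter.Tendsto (fun t => Real.exp (-s * t) * f t) Filter.atTop (nhds 0)) :
    ∫ t in Set.Ioi (0:ℝ), Real.exp (-s * t) *
        ((1 / Real.Gamma (1 - α)) * ∫ τ in (0:ℝ)..t, (t - τ) ^ (-α) * f' τ) =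
      s ^ α * (∫ t in Set.Ioi (0:ℝ), Real.exp (-s * t) * f t) - s ^ (α - 1) * f 0 := by
  obtain ⟨-, hα1⟩ := hα
  have hf := integrableOn_exp_mul_of_abs
    (fun t ht => (hderiv t ht).continuousAt.continuousWithinAt) hf_int
  have hf' := integrableOn_exp_mul_of_abs hcont hf'_int
  have hk : IntegrableOn (fun t : ℝ => Real.exp (-s * t) * t ^ (-α)) (Set.Ioi 0) := by
    have h := integrableOn_rpow_mul_exp_neg_mul_rpow (s := -α) (by linarith) one_pos hs
    simpa only [Real.rpow_one, mul_comm (_ ^ (-α)) (Real.exp _)] using h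
  have hk_val : ∫ t in Set.Ioi (0:ℝ), Real.exp (-s * t) * t ^ (-α) =
      s ^ (α - 1) * Real.Gamma (1 - α) := by
    have h := Real.integral_rpow_mul_exp_neg_mul_Ioi (a := 1 - α) (by linarith) hs
    rw [one_div, Real.inv_rpow hs.le, ← Real.rpow_neg hs.le, neg_sub] at h
    rw [← h]
    congr 1 with t
    rw [mul_comm, neg_mul, show 1 - α - 1 = -α by ring]
  have hΓ : Real.Gamma (1 - α) ≠ 0 := (Real.Gamma_pos_of_pos (by linarith)).ne'
  have hpow : s ^ α = s ^ (α - 1) * s := by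
    rw [← Real.rpow_add_one hs.ne', sub_add_cancel]
  simp only [mul_left_comm (Real.exp _) (1 / Real.Gamma (1 - α))]
  rw [integral_const_mul, integral_exp_mul_convolution (k := fun t => t ^ (-α)) hf' hk, hk_val,
    integral_exp_mul_deriv hderiv hf hf' hlim, hpow]
  field_simp
end

section
/- Let 0 < α < 1, let n ≥ 1, let 0 = t_0 < t_1 < ⋯ < t_n be a partition, and let f : ℝ → ℝ be twice continuously differentiable on [0, t_n]. Then the error of the L1 scheme has the exact representation D^α f(t_n) − L1[f] = (1/Γ(2−α)) Σ_{k=0}^{n−1} ∫_{t_k}^{t_{k+1}} f″(τ) · [ (t_n−τ)^{1−α} − ((t_{k+1}−τ)/(t_{k+1}−t_k)) ((t_n−t_k)^{1−α} − (t_n−t_{k+1})^{1−α}) − (t_n−t_{k+1})^{1−α} ] dτ. -/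
open MeasureTheory Real

/-- The weakly singular kernel `τ ↦ (T - τ) ^ (-α)` is integrable for `α < 1`. -/
lemma intervalIntegrable_sub_rpow_neg {α : ℝ} (hα : α < 1) (T a b : ℝ) :
    IntervalIntegrable (fun τ => (T - τ) ^ (-α)) volume a b := by
  have h := (intervalIntegral.intervalIntegrable_rpow' (a := T - a) (b := T - b)
    (r := -α) (by linarith)).comp_sub_left T
  simpa using h

lemma integral_sub_rpow_neg {α : ℝ} (hα : α < 1) (T a b : ℝ) :
    (1 - α) * ∫ τ in a..b, (T - τ) ^ (-α) = (T - a) ^ (1 - α) - (T - b) ^ (1 - α) := by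
  have h1 : (1 - α) ≠ 0 := by linarith
  rw [intervalIntegral.integral_comp_sub_left (fun x => x ^ (-α)) T,
    integral_rpow (Or.inl (by linarith)), neg_add_eq_sub]
  field_simp

/-- The error of the L1 scheme on a single cell, via integration by parts against a kernel
vanishing at both ends of the cell. -/
lemma L1_error_cell {α T a b : ℝ} (hα : α < 1) (hab : a < b) (hbT : b ≤ T)
    {f f' f'' : ℝ → ℝ}
    (hf' : ∀ x ∈ Set.Icc a b, HasDerivAt f (f' x) x)
    (hf'' : ∀ x ∈ Set.Icc a b, HasDerivAt f' (f'' x) x)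
    (hcont : ContinuousOn f'' (Set.Icc a b)) :
    (∫ τ in a..b, f'' τ *
        ((T - τ) ^ (1 - α) - ((b - τ) / (b - a)) * ((T - a) ^ (1 - α) - (T - b) ^ (1 - α))
          - (T - b) ^ (1 - α))) =
      (1 - α) * ((∫ τ in a..b, (T - τ) ^ (-α) * f' τ) -
        (∫ τ in a..b, (T - τ) ^ (-α)) * ((f b - f a) / (b - a))) := by
  have hd : b - a ≠ 0 := by linarith
  set C := (T - a) ^ (1 - α) - (T - b) ^ (1 - α) with hC
  have hcf' : ContinuousOn f' (Set.uIcc a b) := by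
    rw [Set.uIcc_of_le hab.le]
    exact fun x hx => (hf'' x hx).continuousAt.continuousWithinAt
  have hi := intervalIntegrable_sub_rpow_neg hα T a b
  have hi' : IntervalIntegrable (fun τ => -(1 - α) * (T - τ) ^ (-α) + C / (b - a))
      volume a b := (hi.const_mul _).add intervalIntegrable_const
  have hparts := intervalIntegral.integral_mul_deriv_eq_deriv_mul_of_hasDerivAt
    (a := a) (b := b) (v := f') (v' := f'')
    (u := fun τ => (T - τ) ^ (1 - α) - ((b - τ) / (b - a)) * C - (T - b) ^ (1 - α))
    (u' := fun τ => -(1 - α) * (T - τ) ^ (-α) + C / (b - a))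
    (by
      refine ((ContinuousOn.rpow_const (by fun_prop) ?_).sub (by fun_prop)).sub (by fun_prop)
      exact fun x _ => Or.inr (by linarith))
    hcf'
    (by
      intro x hx
      rw [min_eq_left hab.le, max_eq_right hab.le] at hx
      have hne : T - x ≠ 0 := by linarith [hx.2]
      have h1 := ((hasDerivAt_id x).const_sub T).rpow_const (p := 1 - α) (Or.inl hne)
      have h2 := ((((hasDerivAt_id x).const_sub b).div_const (b - a)).mul_const C)
      refine ((h1.sub h2).sub_const ((T - b) ^ (1 - α))).congr_deriv ?_
      simp only [id, show 1 - α - 1 = -α by ring]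
      ring)
    (by
      intro x hx
      rw [min_eq_left hab.le, max_eq_right hab.le] at hx
      exact hf'' x (Set.Ioo_subset_Icc_self hx))
    hi' (ContinuousOn.intervalIntegrable (by rwa [Set.uIcc_of_le hab.le]))
  have hW := integral_sub_rpow_neg hα T a b
  have hFTC : ∫ τ in a..b, f' τ = f b - f a :=
    intervalIntegral.integral_eq_sub_of_hasDerivAt
      (by rw [Set.uIcc_of_le hab.le]; exact hf') hcf'.intervalIntegrable
  have hsplit : ∫ τ in a..b, (-(1 - α) * (T - τ) ^ (-α) + C / (b - a)) * f' τ =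
      -(1 - α) * (∫ τ in a..b, (T - τ) ^ (-α) * f' τ) + C / (b - a) * (f b - f a) := by
    rw [← hFTC, ← intervalIntegral.integral_const_mul, ← intervalIntegral.integral_const_mul,
      ← intervalIntegral.integral_add ((hi.mul_continuousOn hcf').const_mul _)
        (hcf'.intervalIntegrable.const_mul _)]
    congr 1
    ext τ
    ring
  rw [hsplit] at hparts
  simp only [mul_comm (f'' _)]
  rw [hparts, div_self hd, sub_self]
  linear_combination ((f b - f a) / (b - a)) * hW + (f' a - (f b - f a) / (b - a)) * hC

/-- Exact representation of the error of the L1 scheme for the Caputo fractional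
derivative on an arbitrary partition. -/
theorem L1_error_representation
    (α : ℝ) (hα : α ∈ Set.Ioo (0:ℝ) 1) (n : ℕ) (hn : 1 ≤ n) (t : ℕ → ℝ)
    (ht0 : t 0 = 0) (hmono : ∀ k < n, t k < t (k + 1))
    (f f' f'' : ℝ → ℝ)
    (hf' : ∀ x ∈ Set.Icc 0 (t n), HasDerivAt f (f' x) x)
    (hf'' : ∀ x ∈ Set.Icc 0 (t n), HasDerivAt f' (f'' x) x)
    (hcont : ContinuousOn f'' (Set.Icc 0 (t n))) :
    (1 / Real.Gamma (1 - α)) * (∫ τ in (0:ℝ)..t n, (t n - τ) ^ (-α) * f' τ) -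
      (1 / Real.Gamma (1 - α)) * ∑ k ∈ Finset.range n,
        (∫ τ in t k..t (k + 1), (t n - τ) ^ (-α)) *
          ((f (t (k + 1)) - f (t k)) / (t (k + 1) - t k)) =
    (1 / Real.Gamma (2 - α)) * ∑ k ∈ Finset.range n,
      ∫ τ in t k..t (k + 1), f'' τ *
        ((t n - τ) ^ (1 - α)
          - ((t (k + 1) - τ) / (t (k + 1) - t k)) *
              ((t n - t k) ^ (1 - α) - (t n - t (k + 1)) ^ (1 - α))
          - (t n - t (k + 1)) ^ (1 - α)) := by
  have hle : ∀ j, j ≤ n → ∀ i, i ≤ j → t i ≤ t j := by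
    intro j
    induction j with
    | zero => intro _ i hi; rw [Nat.le_zero.mp hi]
    | succ j ih =>
      intro hj i hi
      rcases Nat.le_succ_iff.mp hi with h | h
      · exact (ih (by omega) i h).trans (hmono j (by omega)).le
      · rw [h]
  have hsub : ∀ k < n, Set.Icc (t k) (t (k + 1)) ⊆ Set.Icc 0 (t n) := fun k hk =>
    Set.Icc_subset_Icc (ht0 ▸ hle k hk.le 0 (Nat.zero_le k)) (hle n le_rfl (k + 1) hk)
  have hcells : ∀ k ∈ Finset.range n, _ := fun k hk =>
    have hk' := Finset.mem_range.mp hk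
    L1_error_cell hα.2 (hmono k hk') (hle n le_rfl (k + 1) hk')
      (fun x hx => hf' x (hsub k hk' hx)) (fun x hx => hf'' x (hsub k hk' hx))
      (hcont.mono (hsub k hk'))
  have hsum := intervalIntegral.sum_integral_adjacent_intervals (a := t) (n := n)
    (f := fun τ => (t n - τ) ^ (-α) * f' τ) (μ := volume) (fun k hk =>
      (intervalIntegrable_sub_rpow_neg hα.2 (t n) _ _).mul_continuousOn (by
        rw [Set.uIcc_of_le (hmono k hk).le]
        exact fun x hx => (hf'' x (hsub k hk hx)).continuousAt.continuousWithinAt))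
  rw [ht0] at hsum
  have h1 : 1 - α ≠ 0 := by linarith [hα.2]
  have hΓ : Real.Gamma (2 - α) = (1 - α) * Real.Gamma (1 - α) := by
    rw [← Real.Gamma_add_one h1]; ring_nf
  have hΓ0 : Real.Gamma (1 - α) ≠ 0 := (Real.Gamma_pos_of_pos (by linarith [hα.2])).ne'
  rw [Finset.sum_congr rfl hcells, ← Finset.mul_sum, Finset.sum_sub_distrib, hsum, hΓ]
  field_simp
end

section
/- Let 0 < α < 1, let n ≥ 1, let 0 = t_0 < t_1 < ⋯ < t_n be a partition, and let f : ℝ → ℝ be twice continuously differentiable on [0, t_n] with |f″(τ)| ≤ M for all τ ∈ [0, t_n]. Then the error of the L1 scheme satisfies |D^α f(t_n) − L1[f]| ≤ (M/(2Γ(3−α))) Σ_{k=0}^{n−1} [ (t_n−t_k)^{1−α} (2(t_n−t_{k+1}) + (t_{k+1}−t_k)α) − (t_n−t_{k+1})^{1−α} (2(t_n−t_k) − (t_{k+1}−t_k)α) ]. -/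
open MeasureTheory Real

/-- A Chebyshev-type inequality: the increasing kernel `(T - τ) ^ (-α)` integrates to a nonpositive
value against a decreasing function of mean zero. -/
lemma integral_sub_rpow_neg_mul_nonpos {α T a b : ℝ} (hα : α ∈ Set.Ioo (0 : ℝ) 1)
    (hab : a < b) (hbT : b ≤ T) {H p : ℝ → ℝ}
    (hH : ∀ x ∈ Set.Icc a b, HasDerivAt H (p x) x) (hp : ContinuousOn p (Set.Icc a b))
    (hanti : AntitoneOn p (Set.Icc a b)) (hends : H a = H b) :
    ∫ τ in a..b, (T - τ) ^ (-α) * p τ ≤ 0 := by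
  have hu : Set.uIcc a b = Set.Icc a b := Set.uIcc_of_le hab.le
  obtain ⟨c, hc, hpc⟩ := exists_hasDerivAt_eq_zero hab
    (fun x hx => (hH x hx).continuousAt.continuousWithinAt) hends
    (fun x hx => hH x (Set.Ioo_subset_Icc_self hx))
  have hpint : IntervalIntegrable p volume a b := (hu ▸ hp).intervalIntegrable
  have hzero : ∫ τ in a..b, p τ = 0 := by
    rw [intervalIntegral.integral_eq_sub_of_hasDerivAt (hu ▸ hH) hpint, hends, sub_self]
  have hle : ∫ τ in a..b, (T - τ) ^ (-α) * p τ ≤ ∫ τ in a..b, (T - c) ^ (-α) * p τ := by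
    refine intervalIntegral.integral_mono_on_of_le_Ioo hab.le
      ((intervalIntegrable_sub_rpow_neg hα.2 T a b).mul_continuousOn (hu ▸ hp))
      (hpint.const_mul _) fun τ hτ => ?_
    have hcI := Set.Ioo_subset_Icc_self hc
    have hτI := Set.Ioo_subset_Icc_self hτ
    have hα0 : -α ≤ 0 := by linarith [hα.1]
    rcases le_total τ c with h | h
    · have hpτ := hanti hτI hcI h
      rw [hpc] at hpτ
      exact mul_le_mul_of_nonneg_right
        (rpow_le_rpow_of_nonpos (by linarith [hc.2]) (by linarith) hα0) hpτ
    · have hpτ := hanti hcI hτI h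
      rw [hpc] at hpτ
      exact mul_le_mul_of_nonpos_right
        (rpow_le_rpow_of_nonpos (by linarith [hτ.2]) (by linarith) hα0) hpτ
  simpa [hzero] using hle

/-- The integral of the kernel `(T - τ) ^ (-α)` against `2 * τ - (a + b)`. -/
lemma integral_sub_rpow_neg_mul_linear {α T a b : ℝ} (hα : α < 1) (hab : a ≤ b) (hbT : b ≤ T) :
    ∫ τ in a..b, (T - τ) ^ (-α) * (2 * τ - (a + b)) =
      ((T - a) ^ (1 - α) * (2 * (T - b) + (b - a) * α)
        - (T - b) ^ (1 - α) * (2 * (T - a) - (b - a) * α)) / ((1 - α) * (2 - α)) := by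
  have hrpow : ∀ u : ℝ, 0 ≤ u → ∀ s : ℝ, 0 < s → u ^ s = u ^ (s - 1) * u := by
    intro u hu s hs
    conv_rhs => rw [← rpow_add_one' hu (by linarith), sub_add_cancel]
  have hsub := intervalIntegral.integral_comp_sub_left (a := a) (b := b)
    (fun u : ℝ => u ^ (-α) * (2 * (T - u) - (a + b))) T
  simp only [sub_sub_cancel] at hsub
  have hsplit : ∫ u in (T - b)..(T - a), u ^ (-α) * (2 * (T - u) - (a + b)) =
      ∫ u in (T - b)..(T - a), ((2 * T - (a + b)) * u ^ (-α) - 2 * u ^ (1 - α)) := by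
    refine intervalIntegral.integral_congr fun u hu => ?_
    rw [Set.uIcc_of_le (by linarith)] at hu
    have h := hrpow u (by linarith [hu.1]) (1 - α) (by linarith)
    rw [show 1 - α - 1 = -α by ring] at h
    simp only [h]
    ring
  rw [hsub, hsplit, intervalIntegral.integral_sub
    ((intervalIntegral.intervalIntegrable_rpow' (by linarith)).const_mul _)
    ((intervalIntegral.intervalIntegrable_rpow' (by linarith)).const_mul _),
    intervalIntegral.integral_const_mul, intervalIntegral.integral_const_mul,
    integral_rpow (Or.inl (by linarith)), integral_rpow (Or.inl (by linarith)),
    show -α + 1 = 1 - α by ring, show 1 - α + 1 = 2 - α by ring,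
    hrpow (T - a) (by linarith) (2 - α) (by linarith),
    hrpow (T - b) (by linarith) (2 - α) (by linarith), show 2 - α - 1 = 1 - α by ring]
  have h1 : 1 - α ≠ 0 := by linarith
  have h2 : 2 - α ≠ 0 := by linarith
  field_simp
  ring

/-- The quadrature error of the L1 scheme on a single cell `[a, b]`. -/
lemma abs_integral_sub_rpow_neg_mul_deriv_sub_le {α M T a b : ℝ} (hα : α ∈ Set.Ioo (0 : ℝ) 1)
    (hab : a < b) (hbT : b ≤ T) {f f' f'' : ℝ → ℝ}
    (hf' : ∀ x ∈ Set.Icc a b, HasDerivAt f (f' x) x)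
    (hf'' : ∀ x ∈ Set.Icc a b, HasDerivAt f' (f'' x) x)
    (hM : ∀ x ∈ Set.Icc a b, |f'' x| ≤ M) :
    |(∫ τ in a..b, (T - τ) ^ (-α) * f' τ) -
        (∫ τ in a..b, (T - τ) ^ (-α)) * ((f b - f a) / (b - a))| ≤
      M / 2 * (((T - a) ^ (1 - α) * (2 * (T - b) + (b - a) * α)
        - (T - b) ^ (1 - α) * (2 * (T - a) - (b - a) * α)) / ((1 - α) * (2 - α))) := by
  set s := (f b - f a) / (b - a) with hs
  have hsb : s * (b - a) = f b - f a := div_mul_cancel₀ _ (by linarith)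
  have hw := intervalIntegrable_sub_rpow_neg hα.2 T a b
  have hcont : ContinuousOn f' (Set.Icc a b) :=
    fun x hx => (hf'' x hx).continuousAt.continuousWithinAt
  have hwf : IntervalIntegrable (fun τ => (T - τ) ^ (-α) * f' τ) volume a b :=
    hw.mul_continuousOn (Set.uIcc_of_le hab.le ▸ hcont)
  have hwl : IntervalIntegrable (fun τ => (T - τ) ^ (-α) * (2 * τ - (a + b))) volume a b :=
    hw.mul_continuousOn (by fun_prop)
  have key : ∀ σ : ℝ, |σ| = 1 →
      σ * ((∫ τ in a..b, (T - τ) ^ (-α) * f' τ) - (∫ τ in a..b, (T - τ) ^ (-α)) * s) ≤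
        M / 2 * ∫ τ in a..b, (T - τ) ^ (-α) * (2 * τ - (a + b)) := by
    intro σ hσ
    have hp : ∀ x ∈ Set.Icc a b, HasDerivAt
        (fun τ => σ * (f' τ - s) - M / 2 * (2 * τ - (a + b))) (σ * f'' x - M) x := by
      intro x hx
      exact ((((hf'' x hx).sub_const s).const_mul σ).sub
        ((((hasDerivAt_id x).const_mul 2).sub_const (a + b)).const_mul (M / 2))).congr_deriv
        (by ring)
    have h := integral_sub_rpow_neg_mul_nonpos hα hab hbT
      (H := fun τ => σ * (f τ - s * τ) - M / 2 * (τ * τ - (a + b) * τ))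
      (p := fun τ => σ * (f' τ - s) - M / 2 * (2 * τ - (a + b)))
      (fun x hx => ((((hf' x hx).sub ((hasDerivAt_id x).const_mul s)).const_mul σ).sub
          ((((hasDerivAt_id x).mul (hasDerivAt_id x)).sub
            ((hasDerivAt_id x).const_mul (a + b))).const_mul (M / 2))).congr_deriv
        (by simp only [id]; ring))
      (fun x hx => (hp x hx).continuousAt.continuousWithinAt)
      (antitoneOn_of_hasDerivWithinAt_nonpos (convex_Icc a b)
        (fun x hx => (hp x hx).continuousAt.continuousWithinAt)
        (fun x hx => (hp x (interior_subset hx)).hasDerivWithinAt)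
        (fun x hx => by
          have := le_abs_self (σ * f'' x)
          rw [abs_mul, hσ, one_mul] at this
          linarith [hM x (interior_subset hx)]))
      (by linear_combination σ * hsb)
    have heq : ∫ τ in a..b, (T - τ) ^ (-α) * (σ * (f' τ - s) - M / 2 * (2 * τ - (a + b))) =
        ∫ τ in a..b, (σ * ((T - τ) ^ (-α) * f' τ - (T - τ) ^ (-α) * s)
          - M / 2 * ((T - τ) ^ (-α) * (2 * τ - (a + b)))) :=
      intervalIntegral.integral_congr fun τ _ => by ring
    rw [heq, intervalIntegral.integral_sub ((hwf.sub (hw.mul_const s)).const_mul σ)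
      (hwl.const_mul _), intervalIntegral.integral_const_mul, intervalIntegral.integral_const_mul,
      intervalIntegral.integral_sub hwf (hw.mul_const s),
      intervalIntegral.integral_mul_const] at h
    linarith
  rw [← integral_sub_rpow_neg_mul_linear hα.2 hab.le hbT]
  exact abs_le.2 ⟨by linarith [key (-1) (by simp)], by linarith [key 1 (by simp)]⟩

/-- L1-norm error bound of the L1 scheme for the Caputo fractional derivative on an
arbitrary (possibly non-uniform) partition. -/
theorem L1_error_bound
    (α M : ℝ) (hα : α ∈ Set.Ioo (0:ℝ) 1) (n : ℕ) (hn : 1 ≤ n) (t : ℕ → ℝ)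
    (ht0 : t 0 = 0) (hmono : ∀ k < n, t k < t (k + 1))
    (f f' f'' : ℝ → ℝ)
    (hf' : ∀ x ∈ Set.Icc 0 (t n), HasDerivAt f (f' x) x)
    (hf'' : ∀ x ∈ Set.Icc 0 (t n), HasDerivAt f' (f'' x) x)
    (hcont : ContinuousOn f'' (Set.Icc 0 (t n)))
    (hM : ∀ τ ∈ Set.Icc 0 (t n), |f'' τ| ≤ M) :
    |(1 / Real.Gamma (1 - α)) * (∫ τ in (0:ℝ)..t n, (t n - τ) ^ (-α) * f' τ) -
      (1 / Real.Gamma (1 - α)) * ∑ k ∈ Finset.range n,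
        (∫ τ in t k..t (k + 1), (t n - τ) ^ (-α)) *
          ((f (t (k + 1)) - f (t k)) / (t (k + 1) - t k))| ≤
    (M / (2 * Real.Gamma (3 - α))) * ∑ k ∈ Finset.range n,
      ((t n - t k) ^ (1 - α) * (2 * (t n - t (k + 1)) + (t (k + 1) - t k) * α)
        - (t n - t (k + 1)) ^ (1 - α) * (2 * (t n - t k) - (t (k + 1) - t k) * α)) := by
  have hmonoOn : ∀ i j, i ≤ j → j ≤ n → t i ≤ t j := by
    intro i j hij
    induction j, hij using Nat.le_induction with
    | base => exact fun _ => le_rfl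
    | succ j _ ih => exact fun hj => (ih (by omega)).trans (hmono j (by omega)).le
  have hsub : ∀ k < n, Set.Icc (t k) (t (k + 1)) ⊆ Set.Icc 0 (t n) := fun k hk =>
    Set.Icc_subset_Icc (ht0 ▸ hmonoOn 0 k k.zero_le hk.le) (hmonoOn (k + 1) n hk le_rfl)
  have hint : ∀ k < n,
      IntervalIntegrable (fun τ => (t n - τ) ^ (-α) * f' τ) volume (t k) (t (k + 1)) := by
    intro k hk
    refine (intervalIntegrable_sub_rpow_neg hα.2 _ _ _).mul_continuousOn fun x hx => ?_
    rw [Set.uIcc_of_le (hmono k hk).le] at hx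
    exact (hf'' x (hsub k hk hx)).continuousAt.continuousWithinAt
  have hG : 0 < Real.Gamma (1 - α) := Real.Gamma_pos_of_pos (by linarith [hα.2])
  have h1 : 0 < 1 - α := by linarith [hα.2]
  have h2 : 0 < 2 - α := by linarith [hα.2]
  have hG3 : Real.Gamma (3 - α) = (2 - α) * ((1 - α) * Real.Gamma (1 - α)) := by
    rw [← Real.Gamma_add_one h1.ne', show 1 - α + 1 = 2 - α by ring,
      ← Real.Gamma_add_one h2.ne', show 2 - α + 1 = 3 - α by ring]
  have hsum := intervalIntegral.sum_integral_adjacent_intervals hint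
  rw [ht0] at hsum
  rw [← hsum, ← mul_sub, ← Finset.sum_sub_distrib, abs_mul, abs_of_pos (one_div_pos.2 hG)]
  refine (mul_le_mul_of_nonneg_left ((Finset.abs_sum_le_sum_abs _ _).trans
    (Finset.sum_le_sum fun k hk => ?_)) (one_div_pos.2 hG).le).trans_eq
    (b := 1 / Real.Gamma (1 - α) * ∑ k ∈ Finset.range n, M / 2 *
      (((t n - t k) ^ (1 - α) * (2 * (t n - t (k + 1)) + (t (k + 1) - t k) * α)
        - (t n - t (k + 1)) ^ (1 - α) * (2 * (t n - t k) - (t (k + 1) - t k) * α))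
        / ((1 - α) * (2 - α)))) ?_
  · have hk := Finset.mem_range.1 hk
    exact abs_integral_sub_rpow_neg_mul_deriv_sub_le hα (hmono k hk)
      (hmonoOn (k + 1) n hk le_rfl) (fun x hx => hf' x (hsub k hk hx))
      (fun x hx => hf'' x (hsub k hk hx)) (fun x hx => hM x (hsub k hk hx))
  · rw [← Finset.mul_sum, ← Finset.sum_div, hG3]
    field_simp
end

section
/- Let 0 < α < 1, λ > 0, and define E : ℝ → ℝ by E(t) = Σ_{k=0}^∞ (−λ)^k t^{αk} / Γ(αk+1) for t ≥ 0. Then for all t > 0, the Caputo fractional derivative of E satisfies (1/Γ(1−α)) ∫₀^t (t−τ)^{−α} E′(τ) dτ = −λ E(t); that is, E(t) = E_α(−λ t^α) solves the fractional relaxation equation D^α E + λ E = 0 with E(0) = 1. -/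
open MeasureTheory Real

/-- A lower bound showing that `Gamma` grows faster than any geometric progression. -/
lemma rpow_mul_exp_neg_le_Gamma {R s : ℝ} (hR : 0 < R) (hs : 1 ≤ s) :
    R ^ (s - 1) * exp (-R) ≤ Gamma s := by
  have hs0 : 0 < s := by linarith
  have h_integral := GammaIntegral_convergent hs0
  have hsub : Set.Ioi R ⊆ Set.Ioi 0 := Set.Ioi_subset_Ioi hR.le
  rw [Gamma_eq_integral hs0, ← integral_exp_neg_Ioi R, ← integral_const_mul]
  calc ∫ x in Set.Ioi R, R ^ (s - 1) * exp (-x)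
      ≤ ∫ x in Set.Ioi R, exp (-x) * x ^ (s - 1) := by
        refine setIntegral_mono_on ((integrableOn_exp_neg_Ioi R).const_mul _)
          (h_integral.mono_set hsub) measurableSet_Ioi fun x hx => ?_
        rw [mul_comm]
        have : R ≤ x := (Set.mem_Ioi.1 hx).le
        gcongr
    _ ≤ ∫ x in Set.Ioi 0, exp (-x) * x ^ (s - 1) := by
        refine setIntegral_mono_set h_integral ?_ hsub.eventuallyLE
        filter_upwards [ae_restrict_mem measurableSet_Ioi] with x hx
        have : 0 < x := hx
        positivity

lemma summable_pow_mul_pow_div_Gamma {α x : ℝ} (hα : 0 < α) (hx : 0 ≤ x) (n : ℕ) :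
    Summable fun k : ℕ => (k : ℝ) ^ n * x ^ k / Gamma (α * k + 1) := by
  set M : ℝ := 2 * x + 1 with hM
  have hM0 : 0 < M := by positivity
  set R : ℝ := M ^ α⁻¹
  have hR : 0 < R := by positivity
  have hRk (k : ℕ) : R ^ (α * k) = M ^ k := by
    rw [← rpow_mul hM0.le, inv_mul_cancel_left₀ hα.ne', rpow_natCast]
  have hr : ‖x / M‖ < 1 := by
    rw [norm_of_nonneg (by positivity), div_lt_one hM0]
    linarith
  refine Summable.of_nonneg_of_le (fun k => ?_) (fun k => ?_)
    ((summable_pow_mul_geometric_of_norm_lt_one n hr).mul_left (exp R))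
  · have : 0 < Gamma (α * k + 1) := Gamma_pos_of_pos (by positivity)
    positivity
  · have hle := rpow_mul_exp_neg_le_Gamma (s := α * k + 1) hR
      (by nlinarith [mul_nonneg hα.le k.cast_nonneg])
    rw [add_sub_cancel_right, hRk] at hle
    calc (k : ℝ) ^ n * x ^ k / Gamma (α * k + 1)
        ≤ (k : ℝ) ^ n * x ^ k / (M ^ k * exp (-R)) := by gcongr
      _ = exp R * ((k : ℝ) ^ n * (x / M) ^ k) := by
        rw [div_pow, exp_neg]
        field_simp

lemma summable_mittagLeffler {α t : ℝ} (c : ℝ) (hα : 0 < α) (ht : 0 ≤ t) :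
    Summable fun k : ℕ => c ^ k * t ^ (α * k) / Gamma (α * k + 1) := by
  refine Summable.of_norm_bounded
    (summable_pow_mul_pow_div_Gamma hα (x := |c| * t ^ α) (by positivity) 0) fun k => ?_
  have : 0 < Gamma (α * k + 1) := Gamma_pos_of_pos (by positivity)
  rw [norm_div, norm_mul, norm_pow, norm_of_nonneg this.le,
    norm_of_nonneg (by positivity : 0 ≤ t ^ (α * k)), rpow_mul ht, rpow_natCast,
    pow_zero, one_mul, mul_pow, norm_eq_abs]

/-- Termwise differentiation of the Mittag-Leffler series. -/
lemma hasDerivAt_mittagLeffler {α t : ℝ} (c : ℝ) (hα : 0 < α) (ht : 0 < t) :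
    HasDerivAt (fun s : ℝ => ∑' k : ℕ, c ^ k * s ^ (α * k) / Gamma (α * k + 1))
      (∑' k : ℕ, c ^ (k + 1) * t ^ (α * (k + 1) - 1) / Gamma (α * (k + 1))) t := by
  have hΓ (k : ℕ) : 0 < Gamma (α * k + 1) := Gamma_pos_of_pos (by positivity)
  have hmem : t ∈ Set.Ioo (t / 2) (2 * t) := ⟨by linarith, by linarith⟩
  have hsum := (summable_pow_mul_pow_div_Gamma hα
    (x := |c| * (2 * t) ^ α) (by positivity) 1).mul_right (α * (t / 2)⁻¹)
  have hbound (k : ℕ) (y : ℝ) (hy : y ∈ Set.Ioo (t / 2) (2 * t)) :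
      ‖c ^ k * (α * k * y ^ (α * k - 1)) / Gamma (α * k + 1)‖ ≤
        (k : ℝ) ^ 1 * (|c| * (2 * t) ^ α) ^ k / Gamma (α * k + 1) * (α * (t / 2)⁻¹) := by
    have hy0 : 0 < y := by linarith [hy.1]
    rw [norm_div, norm_mul, norm_pow, norm_of_nonneg (hΓ k).le,
      norm_of_nonneg (by positivity : 0 ≤ α * k * y ^ (α * k - 1)), norm_eq_abs, mul_pow,
      ← rpow_natCast ((2 * t) ^ α), ← rpow_mul (by positivity),
      rpow_sub_one hy0.ne', pow_one]
    have h₁ : y ^ (α * k) ≤ (2 * t) ^ (α * k) := by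
      gcongr
      exact hy.2.le
    have h₂ : y⁻¹ ≤ (t / 2)⁻¹ := by
      gcongr
      exact hy.1.le
    have := hΓ k
    calc |c| ^ k * (α * k * (y ^ (α * k) / y)) / Gamma (α * k + 1)
        = k * (|c| ^ k * y ^ (α * k)) / Gamma (α * k + 1) * (α * y⁻¹) := by
          ring
      _ ≤ k * (|c| ^ k * (2 * t) ^ (α * k)) / Gamma (α * k + 1) * (α * (t / 2)⁻¹) := by
          gcongr
  have hderiv := hasDerivAt_tsum_of_isPreconnected
    (g := fun (k : ℕ) (s : ℝ) => c ^ k * s ^ (α * k) / Gamma (α * k + 1))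
    hsum isOpen_Ioo isPreconnected_Ioo
    (fun k y hy => (((hasDerivAt_rpow_const (p := α * k)
      (Or.inl (by linarith [hy.1] : 0 < y).ne')).const_mul _).div_const _))
    hbound hmem (summable_mittagLeffler c hα ht.le) hmem
  refine hderiv.congr_deriv ?_
  rw [(Summable.of_norm_bounded hsum fun k => hbound k t hmem).tsum_eq_zero_add]
  simp only [Nat.cast_zero, mul_zero, zero_mul, zero_div, zero_add]
  refine tsum_congr fun k => ?_
  have hk : 0 < α * (k + 1) := by positivity
  have := Gamma_pos_of_pos hk
  push_cast
  rw [Gamma_add_one hk.ne']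
  field_simp

/-- The scaled Beta integral over the reals. -/
lemma integral_sub_rpow_mul_rpow {u v t : ℝ} (hu : 0 < u) (hv : 0 < v) (ht : 0 < t) :
    ∫ x in (0 : ℝ)..t, (t - x) ^ (v - 1) * x ^ (u - 1) =
      t ^ (u + v - 1) * (Gamma u * Gamma v / Gamma (u + v)) := by
  have h := Complex.betaIntegral_scaled u v ht
  rw [Complex.betaIntegral_eq_Gamma_mul_div _ _ (by simpa) (by simpa)] at h
  apply Complex.ofReal_injective
  rw [← intervalIntegral.integral_ofReal]
  push_cast [Complex.ofReal_cpow ht.le, ← Complex.Gamma_ofReal]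
  rw [← h]
  refine intervalIntegral.integral_congr fun x hx => ?_
  rw [Set.uIcc_of_le ht.le] at hx
  push_cast [Complex.ofReal_cpow hx.1, Complex.ofReal_cpow (sub_nonneg.2 hx.2)]
  exact mul_comm _ _

lemma intervalIntegrable_sub_rpow_mul_rpow {u v t : ℝ} (hu : 0 < u) (hv : 0 < v) (ht : 0 < t) :
    IntervalIntegrable (fun x => (t - x) ^ (v - 1) * x ^ (u - 1)) volume 0 t := by
  apply intervalIntegral.intervalIntegrable_of_integral_ne_zero
  rw [integral_sub_rpow_mul_rpow hu hv ht]
  have := Gamma_pos_of_pos hu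
  have := Gamma_pos_of_pos hv
  have := Gamma_pos_of_pos (add_pos hu hv)
  positivity

/-- The Abel kernel integrated against a term of the differentiated Mittag-Leffler series. -/
lemma integral_sub_rpow_mul_mittagLeffler_term {α t : ℝ} (c : ℝ) (hα : α ∈ Set.Ioo (0 : ℝ) 1)
    (ht : 0 < t) (k : ℕ) :
    ∫ τ in (0 : ℝ)..t,
        (t - τ) ^ (-α) * (c ^ (k + 1) * τ ^ (α * (k + 1) - 1) / Gamma (α * (k + 1))) =
      Gamma (1 - α) * c * (c ^ k * t ^ (α * k) / Gamma (α * k + 1)) := by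
  have hk : 0 < α * (k + 1) := mul_pos hα.1 (by positivity)
  have h := integral_sub_rpow_mul_rpow hk (sub_pos.2 hα.2) ht
  rw [show 1 - α - 1 = -α by ring, show α * (k + 1) + (1 - α) = α * k + 1 by ring,
    add_sub_cancel_right] at h
  have := (Gamma_pos_of_pos hk).ne'
  calc _ = ∫ τ in (0 : ℝ)..t, c ^ (k + 1) / Gamma (α * (k + 1)) *
        ((t - τ) ^ (-α) * τ ^ (α * (k + 1) - 1)) := by
        congr 1
        ext τ
        ring
    _ = _ := by
        rw [intervalIntegral.integral_const_mul, h, pow_succ]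
        field_simp

/-- The Mittag-Leffler function `E(t) = E_α(-λ t^α)` solves the fractional
relaxation equation `D^α E + λ E = 0` with `E(0) = 1`. -/
theorem mittagLeffler_solves_relaxation
    (α lam : ℝ) (hα : α ∈ Set.Ioo (0:ℝ) 1) (hlam : 0 < lam)
    (E : ℝ → ℝ)
    (hE : ∀ t ≥ (0:ℝ), E t = ∑' k : ℕ, (-lam) ^ k * t ^ (α * k) / Real.Gamma (α * k + 1)) :
    E 0 = 1 ∧ ∀ t > (0:ℝ),
      (1 / Real.Gamma (1 - α)) * ∫ τ in (0:ℝ)..t, (t - τ) ^ (-α) * deriv E τ =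
        -lam * E t := by
  have hα0 := hα.1
  constructor
  · rw [hE 0 le_rfl, tsum_eq_single 0]
    · simp
    · intro k hk
      rw [zero_rpow (by positivity)]
      simp
  intro t ht
  have hderiv (τ : ℝ) (hτ : 0 < τ) : deriv E τ =
      ∑' k : ℕ, (-lam) ^ (k + 1) * τ ^ (α * (k + 1) - 1) / Gamma (α * (k + 1)) := by
    refine HasDerivAt.deriv ((hasDerivAt_mittagLeffler (-lam) hα0 hτ).congr_of_eventuallyEq ?_)
    filter_upwards [lt_mem_nhds hτ] with s hs using hE s hs.le
  have hsum := hasSum_integral_of_summable_integral_norm (μ := volume.restrict (Set.Ioc 0 t))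
    (F := fun (k : ℕ) τ => (t - τ) ^ (-α) *
      ((-lam) ^ (k + 1) * τ ^ (α * (k + 1) - 1) / Gamma (α * (k + 1)))) (fun k => ?_) ?_
  · simp_rw [← intervalIntegral.integral_of_le ht.le,
      integral_sub_rpow_mul_mittagLeffler_term _ hα ht, tsum_mul_left] at hsum
    have h_integral : ∫ τ in (0 : ℝ)..t, (t - τ) ^ (-α) * deriv E τ =
        Gamma (1 - α) * -lam * E t := by
      rw [hE t ht.le, ← tsum_mul_left, hsum.tsum_eq]
      refine intervalIntegral.integral_congr_ae (.of_forall fun τ hτ => ?_)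
      rw [Set.uIoc_of_le ht.le] at hτ
      rw [hderiv τ hτ.1]
    have := (Gamma_pos_of_pos (sub_pos.2 hα.2)).ne'
    rw [h_integral]
    field_simp
  · have hk : 0 < α * (k + 1) := by positivity
    have h := (intervalIntegrable_sub_rpow_mul_rpow hk (sub_pos.2 hα.2) ht).const_mul
      ((-lam) ^ (k + 1) / Gamma (α * (k + 1)))
    rw [intervalIntegrable_iff_integrableOn_Ioc_of_le ht.le] at h
    refine h.congr (.of_forall fun τ => ?_)
    rw [show 1 - α - 1 = -α by ring]
    ring
  · refine ((summable_mittagLeffler lam hα0 ht.le).mul_left (Gamma (1 - α) * lam)).congr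
      fun k => ?_
    rw [← integral_sub_rpow_mul_mittagLeffler_term _ hα ht, intervalIntegral.integral_of_le ht.le]
    refine setIntegral_congr_fun measurableSet_Ioc fun τ hτ => ?_
    have := Gamma_pos_of_pos (by positivity : 0 < α * (k + 1))
    have := rpow_nonneg (sub_nonneg.2 hτ.2) (-α)
    have := rpow_nonneg hτ.1.le (α * (k + 1) - 1)
    simp only [norm_mul, norm_div, norm_pow, norm_neg, norm_eq_abs]
    rw [abs_of_nonneg, abs_of_nonneg, abs_of_nonneg, abs_of_nonneg] <;> positivity
end

section
/- Let 0 < α < 1, γ > 0, and s > 0 with γ < s^α. Then the Laplace transform of the Mittag-Leffler function of argument −γ t^α satisfies ∫₀^∞ e^{−st} (Σ_{k=0}^∞ (−γ)^k t^{αk}/Γ(αk+1)) dt = s^{α−1}/(s^α + γ). -/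
open MeasureTheory Real

/-- The Laplace transform of `t ^ a / Γ(a + 1)` is `s ^ (-(a + 1))`. -/
theorem integral_exp_neg_mul_rpow_div_Gamma {a s : ℝ} (ha : 0 ≤ a) (hs : 0 < s) :
    ∫ t in Set.Ioi (0:ℝ), Real.exp (-s * t) * (t ^ a / Real.Gamma (a + 1)) =
      s ^ (-(a + 1)) := by
  have hG : Real.Gamma (a + 1) ≠ 0 := (Real.Gamma_pos_of_pos (by linarith)).ne'
  have h := Real.integral_rpow_mul_exp_neg_mul_Ioi (show 0 < a + 1 by linarith) hs
  calc _ = ∫ t in Set.Ioi (0:ℝ),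
        (t ^ (a + 1 - 1) * Real.exp (-(s * t))) / Real.Gamma (a + 1) := by
        congr 1 with t
        rw [add_sub_cancel_right, neg_mul]
        ring
    _ = _ := by
        rw [integral_div, h, mul_div_assoc, div_self hG, mul_one, one_div,
          Real.inv_rpow hs.le, Real.rpow_neg hs.le]

theorem integrableOn_exp_neg_mul_rpow_div_Gamma {a s : ℝ} (ha : 0 ≤ a) (hs : 0 < s) :
    IntegrableOn (fun t : ℝ => Real.exp (-s * t) * (t ^ a / Real.Gamma (a + 1)))
      (Set.Ioi 0) := by
  have h := (integrableOn_rpow_mul_exp_neg_mul_rpow (show -1 < a by linarith)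
    one_pos hs).div_const (Real.Gamma (a + 1))
  refine h.congr (Filter.Eventually.of_forall fun t => ?_)
  simp only [Real.rpow_one]
  ring

/-- Laplace transform of the Mittag-Leffler function:
`L{E_α(-γ t^α)}(s) = s^{α-1}/(s^α + γ)`. -/
theorem laplace_mittagLeffler
    (α γ s : ℝ) (hα : α ∈ Set.Ioo (0:ℝ) 1) (hγ : 0 < γ) (hs : 0 < s)
    (hγs : γ < s ^ α) :
    ∫ t in Set.Ioi (0:ℝ), Real.exp (-s * t) *
        ∑' k : ℕ, (-γ) ^ k * t ^ (α * k) / Real.Gamma (α * k + 1) =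
      s ^ (α - 1) / (s ^ α + γ) := by
  have hsα : 0 < s ^ α := Real.rpow_pos_of_pos hs α
  have hk (k : ℕ) : 0 ≤ α * k := mul_nonneg hα.1.le k.cast_nonneg
  let g (k : ℕ) (t : ℝ) : ℝ := Real.exp (-s * t) * (t ^ (α * k) / Real.Gamma (α * k + 1))
  have hpow (k : ℕ) : s ^ (-(α * k + 1)) = s⁻¹ * ((s ^ α)⁻¹) ^ k := by
    rw [neg_add, Real.rpow_add hs, Real.rpow_neg_one, Real.rpow_neg hs.le,
      Real.rpow_mul_natCast hs.le, inv_pow, mul_comm]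
  have hg (k : ℕ) : ∫ t in Set.Ioi (0:ℝ), g k t = s⁻¹ * ((s ^ α)⁻¹) ^ k :=
    (integral_exp_neg_mul_rpow_div_Gamma (hk k) hs).trans (hpow k)
  have hg_int (k : ℕ) : IntegrableOn (fun t => (-γ) ^ k * g k t) (Set.Ioi 0) :=
    (integrableOn_exp_neg_mul_rpow_div_Gamma (hk k) hs).const_mul _
  have hnorm (k : ℕ) : ∫ t in Set.Ioi (0:ℝ), ‖(-γ) ^ k * g k t‖ =
      s⁻¹ * (γ / s ^ α) ^ k := by
    have : ∫ t in Set.Ioi (0:ℝ), ‖(-γ) ^ k * g k t‖ =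
        ∫ t in Set.Ioi (0:ℝ), γ ^ k * g k t := by
      refine setIntegral_congr_fun measurableSet_Ioi fun t ht => ?_
      have : 0 ≤ g k t := mul_nonneg (Real.exp_nonneg _) (div_nonneg
        (Real.rpow_nonneg (le_of_lt ht) _) (Real.Gamma_nonneg_of_nonneg (by linarith [hk k])))
      simp only [norm_mul, norm_pow, norm_neg, Real.norm_of_nonneg hγ.le,
        Real.norm_of_nonneg this]
    rw [this, integral_const_mul, hg, div_eq_mul_inv, mul_pow]
    ring
  have hsummable : Summable fun k : ℕ => ∫ t in Set.Ioi (0:ℝ), ‖(-γ) ^ k * g k t‖ := by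
    simp_rw [hnorm]
    exact (summable_geometric_of_lt_one (by positivity) ((div_lt_one hsα).2 hγs)).mul_left _
  calc _ = ∫ t in Set.Ioi (0:ℝ), ∑' k : ℕ, (-γ) ^ k * g k t := by
        congr 1 with t
        rw [← tsum_mul_left]
        congr 1 with k
        simp only [g]
        ring
    _ = ∑' k : ℕ, s⁻¹ * (-γ / s ^ α) ^ k := by
        rw [← integral_tsum_of_summable_integral_norm hg_int hsummable]
        congr 1 with k
        rw [integral_const_mul, hg, div_eq_mul_inv, mul_pow]
        ring
    _ = s⁻¹ * (1 - -γ / s ^ α)⁻¹ := by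
        rw [tsum_mul_left, tsum_geometric_of_norm_lt_one]
        rwa [norm_div, norm_neg, Real.norm_of_nonneg hγ.le, Real.norm_of_nonneg hsα.le,
          div_lt_one hsα]
    _ = _ := by
        have : s ^ α + γ ≠ 0 := by positivity
        rw [Real.rpow_sub_one hs.ne', neg_div, sub_neg_eq_add, one_add_div hsα.ne', inv_div]
        field_simp
end
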